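/- arXiv:math/0506028 — 4 statements merged into one kernel-verified Lean document; each statement's English description precedes it below -/
import Mathlib

section
/- (Lemma 1, lower-bound algorithm monotonicity.) Let L : ℝ^n → ℝ be twice continuously differentiable and let B be a symmetric negative definite n×n matrix such that for every β ∈ ℝ^n the matrix ∇²L(β) − B is positive semidefinite. For any β₀ ∈ ℝ^n define the LB iterate β_LB = β₀ − B⁻¹ ∇L(β₀). Then L(β_LB) − L(β₀) ≥ −(1/2) ∇L(β₀)ᵀ B⁻¹ ∇L(β₀) ≥ 0; in particular each LB iteration does not decrease L. -/
open Matrix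

/-- Second-order Taylor lower bound on `[0, 1]` for a function with second derivative at
least `c`. -/
theorem add_deriv_add_half_le_of_le_second_deriv {f f' f'' : ℝ → ℝ} {c : ℝ}
    (hf : ∀ t, HasDerivAt f (f' t) t) (hf' : ∀ t, HasDerivAt f' (f'' t) t)
    (hc : ∀ t, c ≤ f'' t) : f 0 + f' 0 + c / 2 ≤ f 1 := by
  have hmono : Monotone fun t => f' t - c * t :=
    monotone_of_hasDerivAt_nonneg
      (fun t => (hf' t).fun_sub (hasDerivAt_const_mul c))
      (fun t => sub_nonneg.2 (hc t))
  have hderiv : ∀ t, HasDerivAt (fun t => f t - f' 0 * t - c / 2 * t ^ 2)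
      (f' t - f' 0 - c * t) t := fun t => by
    refine (((hf t).fun_sub (hasDerivAt_const_mul (f' 0))).fun_sub
      ((hasDerivAt_pow 2 t).const_mul (c / 2))).congr_deriv ?_
    norm_num
    ring
  have hmonoOn : MonotoneOn (fun t => f t - f' 0 * t - c / 2 * t ^ 2) (Set.Ici 0) := by
    refine monotoneOn_of_deriv_nonneg (convex_Ici 0)
      (fun t _ => (hderiv t).continuousAt.continuousWithinAt)
      (fun t _ => (hderiv t).differentiableAt.differentiableWithinAt) fun t ht => ?_
    rw [interior_Ici, Set.mem_Ioi] at ht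
    rw [(hderiv t).deriv]
    have := hmono ht.le
    simp only [mul_zero] at this
    linarith
  have := hmonoOn Set.self_mem_Ici (Set.mem_Ici.2 zero_le_one) zero_le_one
  norm_num at this
  linarith

/-- A twice continuously differentiable function whose second derivative along `d` is at least
`c` everywhere satisfies `L x + L'(x) d + c / 2 ≤ L (x + d)`. -/
theorem ContDiff.add_fderiv_add_half_le {E : Type*} [NormedAddCommGroup E] [NormedSpace ℝ E]
    {L : E → ℝ} (hL : ContDiff ℝ 2 L) (x d : E) {c : ℝ}
    (hc : ∀ y, c ≤ fderiv ℝ (fun b => fderiv ℝ L b d) y d) :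
    L x + fderiv ℝ L x d + c / 2 ≤ L (x + d) := by
  have hline : ∀ t : ℝ, HasDerivAt (fun t : ℝ => x + t • d) d t := fun t => by
    simpa using ((hasDerivAt_id t).smul_const d).const_add x
  have hL' : Differentiable ℝ fun b => fderiv ℝ L b d :=
    ((hL.fderiv_right (m := 1) (by norm_num)).differentiable (by norm_num)).clm_apply
      (differentiable_const d)
  have key := add_deriv_add_half_le_of_le_second_deriv
    (f := fun t : ℝ => L (x + t • d)) (f' := fun t => fderiv ℝ L (x + t • d) d)
    (f'' := fun t => fderiv ℝ (fun b => fderiv ℝ L b d) (x + t • d) d)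
    (fun t => ((hL.differentiable (by norm_num)) (x + t • d)).hasFDerivAt.comp_hasDerivAt t
      (hline t))
    (fun t => HasFDerivAt.comp_hasDerivAt (l := fun b => fderiv ℝ L b d) t
      (hL' (x + t • d)).hasFDerivAt (hline t))
    (fun t => hc (x + t • d))
  simpa using key

/-- Lemma 1 (lower-bound algorithm monotonicity): the LB iterate
`β_LB = β₀ − B⁻¹ ∇L(β₀)` does not decrease `L`, and in fact increases it by at
least `−(1/2) ∇L(β₀)ᵀ B⁻¹ ∇L(β₀) ≥ 0`. -/
theorem stmt_1 (n : ℕ) (L : (Fin n → ℝ) → ℝ) (hL : ContDiff ℝ 2 L)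
    (g : (Fin n → ℝ) → (Fin n → ℝ)) (Hess : (Fin n → ℝ) → Matrix (Fin n) (Fin n) ℝ)
    (hg : ∀ β v, fderiv ℝ L β v = g β ⬝ᵥ v)
    (hHess : ∀ β u v, fderiv ℝ (fun b => fderiv ℝ L b u) β v = u ⬝ᵥ (Hess β) *ᵥ v)
    (B : Matrix (Fin n) (Fin n) ℝ) (hBsym : B.IsSymm) (hBneg : (-B).PosDef)
    (hLoewner : ∀ β, (Hess β - B).PosSemidef)
    (β₀ βLB : Fin n → ℝ) (hβLB : βLB = β₀ - B⁻¹ *ᵥ g β₀) :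
    L βLB - L β₀ ≥ -(1 / 2) * (g β₀ ⬝ᵥ B⁻¹ *ᵥ g β₀) ∧
    -(1 / 2) * (g β₀ ⬝ᵥ B⁻¹ *ᵥ g β₀) ≥ 0 := by
  have hdet : IsUnit B.det := (Matrix.isUnit_iff_isUnit_det B).1 (by simpa using hBneg.isUnit.neg)
  have hquad : 0 ≤ (B⁻¹ *ᵥ g β₀) ⬝ᵥ (-B) *ᵥ (B⁻¹ *ᵥ g β₀) := by
    simpa using hBneg.posSemidef.dotProduct_mulVec_nonneg (B⁻¹ *ᵥ g β₀)
  have hBinv : B *ᵥ (B⁻¹ *ᵥ g β₀) = g β₀ := by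
    rw [mulVec_mulVec, mul_nonsing_inv _ hdet, one_mulVec]
  rw [neg_mulVec, dotProduct_neg, hBinv, dotProduct_comm] at hquad
  refine ⟨?_, by linarith⟩
  have hle := hL.add_fderiv_add_half_le β₀ (-(B⁻¹ *ᵥ g β₀))
    (c := g β₀ ⬝ᵥ B⁻¹ *ᵥ g β₀) fun y => by
      have h := (hLoewner y).dotProduct_mulVec_nonneg (B⁻¹ *ᵥ g β₀)
      rw [star_trivial, sub_mulVec, dotProduct_sub, hBinv,
        dotProduct_comm (B⁻¹ *ᵥ g β₀) (g β₀)] at h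
      rw [hHess, mulVec_neg, neg_dotProduct_neg]
      linarith
  rw [hg, dotProduct_neg, ← sub_eq_add_neg β₀, ← hβLB] at hle
  linarith
end

section
/- (Lemma 3.) Let K : ℝ → [0, ∞) be symmetric (K(−t) = K(t)) and nonincreasing on [0, ∞) (unimodal). Fix real data points X₁, …, X_n, a fitting point x, and design vectors x_j = (1, X_j−x, …, (X_j−x)^p)ᵀ ∈ ℝ^{p+1}. For h > 0 define A(h) = Σ_{j=1}^n K((X_j − x)/h) x_j x_jᵀ. If 0 < h₁ < h₂ and A(h₁) is positive definite, then A(h₂) is positive definite and e₁ᵀ A(h₁)⁻¹ e₁ ≥ e₁ᵀ A(h₂)⁻¹ e₁, where e₁ = (1,0,…,0)ᵀ. Consequently S(h) = e₁ᵀ A(h)⁻¹ e₁ · K(0) is a nonincreasing function of h on the set of bandwidths for which A(h) is positive definite. -/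
open Matrix

/-- Inversion of positive definite matrices is antitone for the Loewner order, as quadratic forms. -/
theorem Matrix.PosDef.dotProduct_inv_mulVec_anti {m : Type*} [Fintype m] [DecidableEq m]
    {A B : Matrix m m ℝ} (hA : A.PosDef) (hB : B.PosDef) (hAB : (B - A).PosSemidef) (e : m → ℝ) :
    e ⬝ᵥ B⁻¹ *ᵥ e ≤ e ⬝ᵥ A⁻¹ *ᵥ e := by
  set u := A⁻¹ *ᵥ e with hu
  set v := B⁻¹ *ᵥ e with hv
  have hAu : A *ᵥ u = e := by
    rw [hu, mulVec_mulVec, mul_nonsing_inv _ ((isUnit_iff_isUnit_det A).mp hA.isUnit), one_mulVec]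
  have hBv : B *ᵥ v = e := by
    rw [hv, mulVec_mulVec, mul_nonsing_inv _ ((isUnit_iff_isUnit_det B).mp hB.isUnit), one_mulVec]
  have hsymm : u ⬝ᵥ A *ᵥ v = e ⬝ᵥ v := by
    rw [dotProduct_mulVec, ← mulVec_transpose, ← conjTranspose_eq_transpose_of_trivial,
      hA.isHermitian.eq, hAu]
  have hsq := hA.posSemidef.dotProduct_mulVec_nonneg (u - v)
  have hle := hAB.dotProduct_mulVec_nonneg v
  simp only [star_trivial, mulVec_sub, sub_mulVec, dotProduct_sub, sub_dotProduct, hAu, hBv,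
    hsymm, dotProduct_comm u e, dotProduct_comm v e] at hsq hle
  linarith

/-- A symmetric unimodal kernel takes larger values after rescaling by a larger bandwidth. -/
theorem kernel_div_le_kernel_div {K : ℝ → ℝ} (hKsymm : ∀ t, K (-t) = K t)
    (hKmono : AntitoneOn K (Set.Ici 0)) {h₁ h₂ : ℝ} (hh₁ : 0 < h₁) (hh₁₂ : h₁ ≤ h₂) (t : ℝ) :
    K (t / h₁) ≤ K (t / h₂) := by
  have hKabs : ∀ s, K |s| = K s := fun s => by
    rcases abs_choice s with h | h <;> rw [h]
    exact hKsymm s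
  rw [← hKabs (t / h₁), ← hKabs (t / h₂)]
  refine hKmono (Set.mem_Ici.mpr (abs_nonneg _)) (Set.mem_Ici.mpr (abs_nonneg _)) ?_
  rw [abs_div, abs_div, abs_of_pos hh₁, abs_of_pos (hh₁.trans_le hh₁₂)]
  gcongr

/-- Lemma 3: for a symmetric unimodal nonnegative kernel, the local design
matrix `A(h) = Σ_j K((X_j−x)/h) x_j x_jᵀ` is monotone in `h` in the Loewner
order, so `S(h) = e₁ᵀ A(h)⁻¹ e₁ · K(0)` is nonincreasing in `h`. -/
theorem stmt_4 (n p : ℕ) (K : ℝ → ℝ) (hK0 : ∀ t, 0 ≤ K t)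
    (hKsymm : ∀ t, K (-t) = K t) (hKmono : AntitoneOn K (Set.Ici 0))
    (X : Fin n → ℝ) (x : ℝ)
    (xd : Fin n → Fin (p + 1) → ℝ) (hxd : ∀ j i, xd j i = (X j - x) ^ (i : ℕ))
    (A : ℝ → Matrix (Fin (p + 1)) (Fin (p + 1)) ℝ)
    (hA : ∀ h, A h = ∑ j, K ((X j - x) / h) • vecMulVec (xd j) (xd j))
    (h₁ h₂ : ℝ) (hh₁ : 0 < h₁) (hh₁₂ : h₁ < h₂) (hpd : (A h₁).PosDef) :
    (A h₂).PosDef ∧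
    Pi.single (0 : Fin (p + 1)) (1 : ℝ) ⬝ᵥ (A h₂)⁻¹ *ᵥ Pi.single 0 1 ≤
      Pi.single (0 : Fin (p + 1)) (1 : ℝ) ⬝ᵥ (A h₁)⁻¹ *ᵥ Pi.single 0 1 ∧
    (Pi.single (0 : Fin (p + 1)) (1 : ℝ) ⬝ᵥ (A h₂)⁻¹ *ᵥ Pi.single 0 1) * K 0 ≤
      (Pi.single (0 : Fin (p + 1)) (1 : ℝ) ⬝ᵥ (A h₁)⁻¹ *ᵥ Pi.single 0 1) * K 0 := by
  have hdiff : (A h₂ - A h₁).PosSemidef := by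
    rw [hA, hA, ← Finset.sum_sub_distrib]
    refine posSemidef_sum _ fun j _ => ?_
    rw [← sub_smul]
    have hpsd : (vecMulVec (xd j) (xd j)).PosSemidef := by
      simpa using posSemidef_vecMulVec_self_star (xd j)
    exact hpsd.smul (sub_nonneg.mpr (kernel_div_le_kernel_div hKsymm hKmono hh₁ hh₁₂.le _))
  have hpd₂ : (A h₂).PosDef := by
    simpa using hpd.add_posSemidef hdiff
  have hle := hpd.dotProduct_inv_mulVec_anti hpd₂ hdiff (Pi.single 0 1)
  exact ⟨hpd₂, hle, mul_le_mul_of_nonneg_right hle (hK0 0)⟩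
end

section
/- Let b : ℝ → ℝ be twice continuously differentiable with b'' > 0, and suppose b' : ℝ → I is a bijection onto an open interval I ⊂ ℝ with differentiable inverse g = (b')⁻¹. Define q₂ : I → ℝ by q₂(m) = 2·(b(g(m)) − m·g(m)). Then q₂ is differentiable with q₂'(m) = −2·g(m), q₂ is concave, and its Bregman divergence equals the deviance loss: for all y, m̂ ∈ I, Q₂(y, m̂) = q₂(m̂) + q₂'(m̂)(y − m̂) − q₂(y) = 2·{ y·(g(y) − g(m̂)) − b(g(y)) + b(g(m̂)) }. -/
/-- The deviance loss as a Bregman divergence: with `b'' > 0`, `g = (b')⁻¹` a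
differentiable inverse on the open interval `I`, and
`q₂(m) = 2(b(g(m)) − m g(m))`, the function `q₂` is differentiable with
`q₂'(m) = −2 g(m)`, concave, and its Bregman divergence equals the deviance
`2{y(g(y) − g(mhat)) − b(g(y)) + b(g(mhat))}`. -/
theorem stmt_12 (b : ℝ → ℝ) (hb : ContDiff ℝ 2 b)
    (hb'' : ∀ θ, 0 < deriv (deriv b) θ)
    (I : Set ℝ) (hIopen : IsOpen I) (hIconn : I.OrdConnected)
    (g : ℝ → ℝ) (hmem : ∀ θ, deriv b θ ∈ I)
    (hsurj : ∀ m ∈ I, ∃ θ, deriv b θ = m)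
    (hgl : ∀ θ, g (deriv b θ) = θ) (hgr : ∀ m ∈ I, deriv b (g m) = m)
    (hgdiff : DifferentiableOn ℝ g I)
    (q₂ : ℝ → ℝ) (hq₂ : ∀ m ∈ I, q₂ m = 2 * (b (g m) - m * g m)) :
    (∀ m ∈ I, HasDerivAt q₂ (-2 * g m) m) ∧
    ConcaveOn ℝ I q₂ ∧
    ∀ y ∈ I, ∀ mhat ∈ I,
      q₂ mhat + deriv q₂ mhat * (y - mhat) - q₂ y =
        2 * (y * (g y - g mhat) - b (g y) + b (g mhat)) := by
  have hmono : StrictMono (deriv b) := strictMono_of_deriv_pos hb''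
  have hg : MonotoneOn g I := fun x hx y hy hxy => by
    rwa [← hmono.le_iff_le, hgr x hx, hgr y hy]
  have hq : ∀ m ∈ I, HasDerivAt q₂ (-2 * g m) m := fun m hm => by
    have hI : I ∈ nhds m := hIopen.mem_nhds hm
    have hgm : HasDerivAt g (deriv g m) m := (hgdiff.differentiableAt hI).hasDerivAt
    have hbm : HasDerivAt b m (g m) := by
      simpa only [hgr m hm] using (hb.differentiable (by norm_num) (g m)).hasDerivAt
    have h : HasDerivAt (fun x => 2 * (b (g x) - x * g x)) (-2 * g m) m := by
      refine (((hbm.comp m hgm).sub ((hasDerivAt_id' m).mul hgm)).const_mul 2).congr_deriv ?_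
      ring
    exact h.congr_of_eventuallyEq (Filter.eventually_of_mem hI hq₂)
  refine ⟨hq, ?_, fun y hy mhat hm => ?_⟩
  · refine AntitoneOn.concaveOn_of_deriv hIconn.convex
      (fun m hm => (hq m hm).continuousAt.continuousWithinAt) ?_ ?_ <;> rw [hIopen.interior_eq]
    · exact fun m hm => (hq m hm).differentiableAt.differentiableWithinAt
    · intro x hx y hy hxy
      rw [(hq x hx).deriv, (hq y hy).deriv]
      linarith [hg hx hy hxy]
  · rw [(hq mhat hm).deriv, hq₂ y hy, hq₂ mhat hm]
    ring
end

section
/- On (0, 1), the function q₃(m) = 2·√(m(1 − m)) is concave and differentiable with q₃'(m) = (1 − 2m)/√(m(1 − m)), and for y ∈ {0, 1} and m̂ ∈ (0, 1) its Bregman divergence equals the exponential loss: Q₃(y, m̂) = q₃(m̂) + q₃'(m̂)(y − m̂) − q₃(y) = exp{ −(y − 1/2)·ln(m̂/(1 − m̂)) } = (m̂/(1−m̂))^{1/2 − y}, where q₃ is extended by continuity so that q₃(0) = q₃(1) = 0. -/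
theorem concaveOn_two_mul_sqrt_mul_one_sub :
    ConcaveOn ℝ (Set.Ioo (0 : ℝ) 1) fun m => 2 * √(m * (1 - m)) := by
  refine ⟨convex_Ioo 0 1, fun x hx y hy a b ha hb hab => ?_⟩
  obtain ⟨hx0, hx1⟩ := hx
  obtain ⟨hy0, hy1⟩ := hy
  have hsqrt := Real.strictConcaveOn_sqrt.concaveOn.2
    (Set.mem_Ici.2 (mul_pos hx0 (sub_pos.2 hx1)).le)
    (Set.mem_Ici.2 (mul_pos hy0 (sub_pos.2 hy1)).le) ha hb hab
  have hle : a * (x * (1 - x)) + b * (y * (1 - y)) ≤ (a * x + b * y) * (1 - (a * x + b * y)) := by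
    obtain rfl : b = 1 - a := by linarith
    nlinarith [mul_nonneg (mul_nonneg ha hb) (sq_nonneg (x - y))]
  have hmono := Real.sqrt_le_sqrt hle
  simp only [smul_eq_mul] at hsqrt ⊢
  linarith

theorem hasDerivAt_two_mul_sqrt_mul_one_sub {m : ℝ} (hm : m ∈ Set.Ioo (0 : ℝ) 1) :
    HasDerivAt (fun m => 2 * √(m * (1 - m))) ((1 - 2 * m) / √(m * (1 - m))) m := by
  have hpos : 0 < m * (1 - m) := mul_pos hm.1 (sub_pos.2 hm.2)
  have hinner : HasDerivAt (fun m : ℝ => m * (1 - m)) (1 * (1 - m) + m * (-1)) m :=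
    (hasDerivAt_id' m).mul ((hasDerivAt_id' m).const_sub 1)
  refine ((hinner.sqrt hpos.ne').const_mul 2).congr_deriv ?_
  have := (Real.sqrt_pos.2 hpos).ne'
  field_simp
  ring

theorem div_sqrt_mul_eq_sqrt_div {a : ℝ} (ha : 0 ≤ a) (b : ℝ) :
    a / √(a * b) = √(a / b) := by
  rw [Real.sqrt_mul ha, Real.sqrt_div ha, ← div_div, Real.div_sqrt]

/-- The exponential loss as a Bregman divergence: on `(0,1)` the function
`q₃(m) = 2√(m(1−m))` (extended by `q₃(0)=q₃(1)=0`) is concave, differentiable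
with `q₃'(m) = (1−2m)/√(m(1−m))`, and for `y ∈ {0,1}` its Bregman divergence
equals `exp{−(y−1/2) ln(m̂/(1−m̂))} = (m̂/(1−m̂))^{1/2−y}`. -/
theorem stmt_14 (q₃ : ℝ → ℝ)
    (hq₃ : ∀ m ∈ Set.Ioo (0 : ℝ) 1, q₃ m = 2 * Real.sqrt (m * (1 - m)))
    (hq₃0 : q₃ 0 = 0) (hq₃1 : q₃ 1 = 0) :
    ConcaveOn ℝ (Set.Ioo 0 1) q₃ ∧
    (∀ m ∈ Set.Ioo (0 : ℝ) 1,
      HasDerivAt q₃ ((1 - 2 * m) / Real.sqrt (m * (1 - m))) m) ∧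
    (∀ y ∈ ({0, 1} : Set ℝ), ∀ mhat ∈ Set.Ioo (0 : ℝ) 1,
      q₃ mhat + deriv q₃ mhat * (y - mhat) - q₃ y =
        Real.exp (-(y - 1 / 2) * Real.log (mhat / (1 - mhat))) ∧
      q₃ mhat + deriv q₃ mhat * (y - mhat) - q₃ y =
        (mhat / (1 - mhat)) ^ ((1 : ℝ) / 2 - y)) := by
  have hderiv : ∀ m ∈ Set.Ioo (0 : ℝ) 1,
      HasDerivAt q₃ ((1 - 2 * m) / √(m * (1 - m))) m := fun m hm =>
    (hasDerivAt_two_mul_sqrt_mul_one_sub hm).congr_of_eventuallyEq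
      (Filter.eventually_of_mem (isOpen_Ioo.mem_nhds hm) hq₃)
  refine ⟨concaveOn_two_mul_sqrt_mul_one_sub.congr fun m hm => (hq₃ m hm).symm, hderiv, ?_⟩
  intro y hy m hm
  have hm0 : 0 < m := hm.1
  have hm1 : 0 < 1 - m := sub_pos.2 hm.2
  have hpos : 0 < m * (1 - m) := mul_pos hm0 hm1
  have hne := (Real.sqrt_pos.2 hpos).ne'
  have hsq := Real.sq_sqrt hpos.le
  have hrpow : q₃ m + deriv q₃ m * (y - m) - q₃ y = (m / (1 - m)) ^ ((1 : ℝ) / 2 - y) := by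
    rw [(hderiv m hm).deriv, hq₃ m hm]
    rcases hy with rfl | rfl
    · rw [hq₃0, sub_zero (1 / 2 : ℝ), ← Real.sqrt_eq_rpow, ← div_sqrt_mul_eq_sqrt_div hm0.le]
      field_simp
      rw [hsq]
      ring
    · rw [hq₃1, show (1 / 2 - 1 : ℝ) = -(1 / 2) by norm_num,
        Real.rpow_neg (div_pos hm0 hm1).le, ← Real.inv_rpow (div_pos hm0 hm1).le, inv_div,
        ← Real.sqrt_eq_rpow, ← div_sqrt_mul_eq_sqrt_div hm1.le, mul_comm (1 - m) m]
      field_simp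
      rw [hsq]
      ring
  refine ⟨?_, hrpow⟩
  rw [hrpow, Real.rpow_def_of_pos (div_pos hm0 hm1)]
  ring_nf
end
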